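/- Let s < 0, N ≥ 1, and let u : ℝ → 𝒮(ℝ) be a continuously differentiable curve of real-valued Schwartz functions solving the quartic KdV equation ∂_t u + ∂_x³u = ∂_x(u⁴). Define E₁(t) = ∫_ℝ m(ξ)² |û(t,ξ)|² dξ (Fourier transform in x). Then for every t ∈ ℝ, E₁(t) − E₁(0) = −(2i/5)·(2π)^{−3} ∫₀ᵗ Λ₅( m(ξ₁)²ξ₁ + m(ξ₂)²ξ₂ + m(ξ₃)²ξ₃ + m(ξ₄)²ξ₄ + m(ξ₅)²ξ₅ ; u(σ) ) dσ. -/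

import Mathlib

open MeasureTheory

noncomputable section

/-- 1D Fourier transform  f̂(ξ) = ∫ e^{-ixξ} f(x) dx. -/
def FTs (f : ℝ → ℂ) (ξ : ℝ) : ℂ :=
  ∫ x : ℝ, Complex.exp (-(Complex.I * ((x * ξ : ℝ) : ℂ))) * f x

/-- Extend a vector of `n-1` frequencies to `n` frequencies summing to zero. -/
def padZero (n : ℕ) (v : Fin (n - 1) → ℝ) : Fin n → ℝ :=
  fun j => if h : (j : ℕ) < n - 1 then v ⟨j, h⟩ else -(∑ i, v i)

/-- Multilinear functional Λ_n(M; f) = ∫_{ξ₁+⋯+ξ_n=0} M ∏ f̂(ξ_j). -/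
def Lam (n : ℕ) (M : (Fin n → ℝ) → ℂ) (f : ℝ → ℂ) : ℂ :=
  ∫ v : Fin (n - 1) → ℝ, M (padZero n v) * ∏ j, FTs f (padZero n v j)

/-- The I-method multiplier m. -/
def mI (s N ξ : ℝ) : ℝ := if |ξ| ≤ N then 1 else (|ξ| / N) ^ s

/-- The first modified energy E₁(t) = ∫ m(ξ)²|û(t,ξ)|² dξ. -/
def E1 (s N : ℝ) (u : ℝ → SchwartzMap ℝ ℝ) (t : ℝ) : ℝ :=
  ∫ ξ : ℝ, mI s N ξ ^ 2 * ‖FTs (fun x => ((u t) x : ℂ)) ξ‖ ^ 2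

open scoped SchwartzMap FourierTransform

/-- The scaling `ξ ↦ ξ / (2π)` as a continuous linear equivalence of the line. -/
def scaleEquiv : ℝ ≃L[ℝ] ℝ :=
  ContinuousLinearEquiv.unitsEquivAut ℝ
    (Units.mk0 (2 * Real.pi)⁻¹ (inv_ne_zero Real.two_pi_pos.ne'))

lemma scaleEquiv_apply (ξ : ℝ) : scaleEquiv ξ = ξ * (2 * Real.pi)⁻¹ := rfl

/-- The transform `FTs` as a continuous linear map on Schwartz functions. -/
def schwartzFTs : 𝓢(ℝ, ℂ) →L[ℝ] 𝓢(ℝ, ℂ) :=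
  (SchwartzMap.compCLMOfContinuousLinearEquiv ℝ scaleEquiv).comp
    (FourierTransform.fourierCLM ℝ 𝓢(ℝ, ℂ))

lemma schwartzFTs_apply_eq_fourier (f : 𝓢(ℝ, ℂ)) (ξ : ℝ) :
    schwartzFTs f ξ = 𝓕 f (ξ * (2 * Real.pi)⁻¹) := rfl

lemma FTs_eq_schwartzFTs (f : 𝓢(ℝ, ℂ)) : FTs f = schwartzFTs f := by
  ext ξ
  rw [schwartzFTs_apply_eq_fourier, SchwartzMap.fourier_coe, Real.fourier_real_eq_integral_exp_smul]
  refine integral_congr_ae (Filter.Eventually.of_forall fun x => ?_)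
  have hπ : (Real.pi : ℂ) ≠ 0 := by exact_mod_cast Real.pi_ne_zero
  simp only [smul_eq_mul]
  congr 2
  push_cast
  field_simp

lemma schwartzFTs_deriv (f : 𝓢(ℝ, ℂ)) (ξ : ℝ) :
    schwartzFTs (SchwartzMap.derivCLM ℝ ℂ f) ξ = Complex.I * ξ * schwartzFTs f ξ := by
  have h := congrFun (Real.fourier_deriv f.integrable f.differentiable
    (SchwartzMap.derivCLM ℝ ℂ f).integrable) (ξ * (2 * Real.pi)⁻¹)
  have hπ : (Real.pi : ℂ) ≠ 0 := by exact_mod_cast Real.pi_ne_zero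
  rw [schwartzFTs_apply_eq_fourier, schwartzFTs_apply_eq_fourier, SchwartzMap.fourier_coe,
    SchwartzMap.fourier_coe]
  refine h.trans ?_
  rw [smul_eq_mul]
  push_cast
  field_simp

lemma schwartzFTs_neg_of_real (f : 𝓢(ℝ, ℂ)) (hf : ∀ x, (starRingEnd ℂ) (f x) = f x) (ξ : ℝ) :
    schwartzFTs f (-ξ) = (starRingEnd ℂ) (schwartzFTs f ξ) := by
  rw [← FTs_eq_schwartzFTs, FTs, FTs, ← integral_conj]
  refine integral_congr_ae (Filter.Eventually.of_forall fun x => ?_)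
  simp [← Complex.exp_conj, hf]

open scoped Convolution in
lemma fourier_pairing_mul (f g : 𝓢(ℝ, ℂ)) :
    𝓕 (SchwartzMap.pairing (ContinuousLinearMap.mul ℂ ℂ) f g) =
      SchwartzMap.convolution (ContinuousLinearMap.mul ℂ ℂ) (𝓕 f) (𝓕 g) := by
  have h : 𝓕⁻ (SchwartzMap.convolution (ContinuousLinearMap.mul ℂ ℂ) (𝓕 f) (𝓕 g)) =
      SchwartzMap.pairing (ContinuousLinearMap.mul ℂ ℂ) f g := by
    have key : ∀ (k : 𝓢(ℝ, ℂ)) (x : ℝ), 𝓕⁻ k x = 𝓕 k (-x) := fun k x => rfl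
    ext x
    rw [key, SchwartzMap.fourier_convolution, SchwartzMap.pairing_apply_apply,
      SchwartzMap.pairing_apply_apply, ← key, ← key]
    simp
  rw [← h]
  simp

lemma schwartzFTs_pairing_mul (f g : 𝓢(ℝ, ℂ)) (ξ : ℝ) :
    (2 * Real.pi : ℂ) * schwartzFTs (SchwartzMap.pairing (ContinuousLinearMap.mul ℂ ℂ) f g) ξ =
      ∫ x, schwartzFTs f x * schwartzFTs g (ξ - x) := by
  rw [schwartzFTs_apply_eq_fourier, fourier_pairing_mul, SchwartzMap.convolution_apply,
    MeasureTheory.convolution_def]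
  simp only [schwartzFTs_apply_eq_fourier, sub_mul, ContinuousLinearMap.mul_apply']
  rw [Measure.integral_comp_mul_right
    (fun y => 𝓕 f y * 𝓕 g (ξ * (2 * Real.pi)⁻¹ - y)) (2 * Real.pi)⁻¹, inv_inv,
    abs_of_pos Real.two_pi_pos, Complex.real_smul]
  push_cast
  rfl

/-- The power `f ^ (n + 1)` of a Schwartz function. -/
def schwartzPow (f : 𝓢(ℝ, ℂ)) : ℕ → 𝓢(ℝ, ℂ)
  | 0 => f
  | n + 1 => SchwartzMap.pairing (ContinuousLinearMap.mul ℂ ℂ) f (schwartzPow f n)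

lemma schwartzPow_apply (f : 𝓢(ℝ, ℂ)) (n : ℕ) (x : ℝ) : schwartzPow f n x = f x ^ (n + 1) := by
  induction n with
  | zero => simp [schwartzPow]
  | succ n ih =>
    rw [schwartzPow, SchwartzMap.pairing_apply_apply, ih, ContinuousLinearMap.mul_apply']
    ring

/-- Fubini for functions of a sum: `G n` is the `(n + 1)`-fold convolution power of `F`. -/
lemma integral_comp_sum_mul_prod {F : ℝ → ℂ} {G : ℕ → ℝ → ℂ} (hF : Integrable F)
    (hG : ∀ n, Integrable (G n)) (h0 : G 0 = F)
    (hsucc : ∀ n ξ, G (n + 1) ξ = ∫ x, F x * G n (ξ - x)) (n : ℕ) {K : ℝ → ℂ}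
    (hK : Continuous K) {C : ℝ} (hC : ∀ ξ, ‖K ξ‖ ≤ C) :
    ∫ v : Fin (n + 1) → ℝ, K (∑ i, v i) * ∏ i, F (v i) = ∫ ξ, K ξ * G n ξ := by
  induction n generalizing K with
  | zero =>
    subst h0
    rw [← (volume_preserving_funUnique (Fin 1) ℝ).integral_comp'
      (g := fun ξ => K ξ * G 0 ξ)]
    simp [MeasurableEquiv.funUnique]
    rfl
  | succ n ih =>
    have hprod : Integrable (fun w : Fin (n + 1) → ℝ => ∏ i, F (w i)) :=
      Integrable.fintype_prod (fun _ => hF)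
    have hint : Integrable (fun p : ℝ × (Fin (n + 1) → ℝ) =>
        K (p.1 + ∑ i, p.2 i) * (F p.1 * ∏ i, F (p.2 i))) (volume.prod volume) :=
      (hF.mul_prod hprod).bdd_mul (Continuous.aestronglyMeasurable (by fun_prop))
        (Filter.Eventually.of_forall fun p => hC _)
    have hint' : Integrable (fun p : ℝ × ℝ => K p.2 * (F p.1 * G n (p.2 - p.1)))
        (volume.prod volume) := by
      refine Integrable.bdd_mul ?_ (Continuous.aestronglyMeasurable (by fun_prop))
        (Filter.Eventually.of_forall fun p => hC _)
      exact (hF.convolution_integrand (ContinuousLinearMap.mul ℝ ℂ) (hG n)).swap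
    have e := (volume_preserving_piFinSuccAbove (fun _ : Fin (n + 2) => ℝ) 0).symm
    rw [← e.integral_comp']
    calc _ = ∫ p : ℝ × (Fin (n + 1) → ℝ), K (p.1 + ∑ i, p.2 i) * (F p.1 * ∏ i, F (p.2 i)) := by
          refine integral_congr_ae (Filter.Eventually.of_forall fun p => ?_)
          simp [MeasurableEquiv.piFinSuccAbove, Fin.sum_univ_succ, Fin.prod_univ_succ]
      _ = ∫ x, F x * ∫ w : Fin (n + 1) → ℝ, K (x + ∑ i, w i) * ∏ i, F (w i) := by
          rw [Measure.volume_eq_prod, integral_prod _ hint]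
          congr 1 with x
          rw [← integral_const_mul]
          congr 1 with w
          ring
      _ = ∫ x, ∫ η, K η * (F x * G n (η - x)) := by
          congr 1 with x
          rw [ih (K := fun y => K (x + y)) (by fun_prop) (fun _ => hC _),
            ← integral_const_mul,
            ← integral_sub_right_eq_self (fun η => F x * (K (x + η) * G n η)) x]
          congr 1 with η
          rw [add_sub_cancel]
          ring
      _ = ∫ η, ∫ x, K η * (F x * G n (η - x)) := integral_integral_swap hint'
      _ = _ := by
          congr 1 with η
          rw [hsucc, integral_const_mul]

lemma padZero_castSucc {n : ℕ} (v : Fin n → ℝ) (i : Fin n) :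
    padZero (n + 1) v i.castSucc = v i := by
  simp [padZero]

lemma padZero_last {n : ℕ} (v : Fin n → ℝ) :
    padZero (n + 1) v (Fin.last n) = -∑ i, v i := by
  simp [padZero]

/-- The reflection exchanging the `j`-th frequency with the dependent one. -/
def reflectFreq {n : ℕ} (j : Fin n) : (Fin n → ℝ) →ₗ[ℝ] (Fin n → ℝ) where
  toFun v := Function.update v j (-∑ i, v i)
  map_add' v w := by
    ext i
    rcases eq_or_ne i j with rfl | h <;> simp [*, Finset.sum_add_distrib, add_comm]
  map_smul' c v := by
    ext i
    rcases eq_or_ne i j with rfl | h <;> simp [*, Finset.mul_sum]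

lemma reflectFreq_apply {n : ℕ} (j : Fin n) (v : Fin n → ℝ) :
    reflectFreq j v = Function.update v j (-∑ i, v i) := rfl

lemma sum_reflectFreq {n : ℕ} (j : Fin n) (v : Fin n → ℝ) : ∑ i, reflectFreq j v i = -v j := by
  rw [reflectFreq_apply, Finset.sum_update_of_mem (Finset.mem_univ j),
    Finset.sum_eq_add_sum_sdiff_singleton_of_mem (Finset.mem_univ j) v]
  ring

lemma padZero_reflectFreq {n : ℕ} (j : Fin n) (v : Fin n → ℝ) (i : Fin (n + 1)) :
    padZero (n + 1) (reflectFreq j v) i =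
      padZero (n + 1) v (Equiv.swap j.castSucc (Fin.last n) i) := by
  induction i using Fin.lastCases with
  | last =>
    rw [Equiv.swap_apply_right, padZero_last, padZero_castSucc, sum_reflectFreq, neg_neg]
  | cast i =>
    rw [padZero_castSucc, reflectFreq_apply]
    rcases eq_or_ne i j with rfl | h
    · rw [Equiv.swap_apply_left, padZero_last, Function.update_self]
    · rw [Equiv.swap_apply_of_ne_of_ne (by simpa using h) (Fin.castSucc_lt_last i).ne,
        padZero_castSucc, Function.update_of_ne h]

lemma reflectFreq_comp_self {n : ℕ} (j : Fin n) :
    reflectFreq j ∘ₗ reflectFreq j = LinearMap.id := by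
  ext1 v
  ext w
  simp only [LinearMap.comp_apply, LinearMap.id_apply]
  rw [reflectFreq_apply, sum_reflectFreq, reflectFreq_apply]
  simp

lemma measurePreserving_reflectFreq {n : ℕ} (j : Fin n) : MeasurePreserving (reflectFreq j) := by
  have hdet : LinearMap.det (reflectFreq j) * LinearMap.det (reflectFreq j) = 1 := by
    rw [← LinearMap.det_comp, reflectFreq_comp_self, LinearMap.det_id]
  have habs : |(LinearMap.det (reflectFreq j))⁻¹| = 1 := by
    rw [abs_inv, inv_eq_one]
    rcases mul_self_eq_one_iff.1 hdet with h | h <;> simp [h]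
  refine ⟨(reflectFreq j).continuous_of_finiteDimensional.measurable, ?_⟩
  rw [Measure.map_linearMap_addHaar_eq_smul_addHaar _ (left_ne_zero_of_mul_eq_one hdet), habs]
  simp

lemma measurableEmbedding_reflectFreq {n : ℕ} (j : Fin n) :
    MeasurableEmbedding (reflectFreq j) := by
  have hc := (reflectFreq j).continuous_of_finiteDimensional
  have hinv : Function.LeftInverse (reflectFreq j) (reflectFreq j) :=
    fun v => LinearMap.congr_fun (reflectFreq_comp_self j) v
  exact (Homeomorph.mk ⟨reflectFreq j, reflectFreq j, hinv, hinv⟩ hc hc).measurableEmbedding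

/-- A symmetric sum over frequencies integrates to a multiple of the last summand. -/
lemma integral_sum_mul_prod_padZero {n : ℕ} {g W : ℝ → ℂ}
    (hint : Integrable fun v : Fin n → ℝ => g (-∑ i, v i) * ∏ j, W (padZero (n + 1) v j)) :
    ∫ v : Fin n → ℝ, (∑ j, g (padZero (n + 1) v j)) * ∏ j, W (padZero (n + 1) v j) =
      (n + 1) * ∫ v : Fin n → ℝ, g (-∑ i, v i) * ∏ j, W (padZero (n + 1) v j) := by
  set Φ : (Fin n → ℝ) → ℂ := fun v => g (-∑ i, v i) * ∏ j, W (padZero (n + 1) v j) with hΦ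
  have hlast : (fun v : Fin n → ℝ =>
      g (padZero (n + 1) v (Fin.last n)) * ∏ i, W (padZero (n + 1) v i)) = Φ := by
    ext v
    rw [padZero_last]
  have hcast : ∀ j : Fin n, (fun v : Fin n → ℝ =>
      g (padZero (n + 1) v j.castSucc) * ∏ i, W (padZero (n + 1) v i)) = Φ ∘ reflectFreq j := by
    intro j
    ext v
    rw [Function.comp_apply, ← hlast]
    simp only [padZero_reflectFreq, Equiv.swap_apply_right]
    rw [Equiv.prod_comp (Equiv.swap j.castSucc (Fin.last n)) (fun i => W (padZero (n + 1) v i))]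
  simp_rw [Finset.sum_mul]
  rw [integral_finsetSum]
  · rw [Fin.sum_univ_castSucc, hlast]
    simp_rw [hcast]
    simp_rw [Function.comp_def, (measurePreserving_reflectFreq _).integral_comp
      (measurableEmbedding_reflectFreq _) Φ]
    simp
    ring
  · intro j _
    induction j using Fin.lastCases with
    | last => rw [hlast]; exact hint
    | cast j =>
      rw [hcast]
      exact (measurePreserving_reflectFreq j).integrable_comp_of_integrable hint

lemma mI_eq_max_rpow {s N : ℝ} (hN : 0 < N) (ξ : ℝ) : mI s N ξ = max (|ξ| / N) 1 ^ s := by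
  unfold mI
  split_ifs with h
  · rw [max_eq_right ((div_le_one hN).2 h), Real.one_rpow]
  · rw [max_eq_left ((one_le_div hN).2 (not_le.1 h).le)]

lemma continuous_mI {s N : ℝ} (hN : 0 < N) : Continuous (mI s N) := by
  simp_rw [funext (mI_eq_max_rpow (s := s) hN)]
  exact Continuous.rpow_const (by fun_prop)
    fun ξ => Or.inl (zero_lt_one.trans_le (le_max_right _ _)).ne'

lemma mI_nonneg {s N : ℝ} (hN : 0 < N) (ξ : ℝ) : 0 ≤ mI s N ξ := by
  rw [mI_eq_max_rpow hN]
  positivity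

lemma mI_le_one {s N : ℝ} (hs : s ≤ 0) (hN : 0 < N) (ξ : ℝ) : mI s N ξ ≤ 1 := by
  rw [mI_eq_max_rpow hN]
  exact Real.rpow_le_one_of_one_le_of_nonpos (le_max_right _ _) hs

lemma mI_neg (s N ξ : ℝ) : mI s N (-ξ) = mI s N ξ := by
  simp [mI]

/-- The factor depending on the last frequency in the symmetrised form `Lam`. -/
def lastFreqFactor (s N : ℝ) (f : 𝓢(ℝ, ℂ)) (ξ : ℝ) : ℂ :=
  ((mI s N (-ξ) ^ 2 * (-ξ) : ℝ) : ℂ) * schwartzFTs f (-ξ)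

lemma continuous_lastFreqFactor {s N : ℝ} (hN : 0 < N) (f : 𝓢(ℝ, ℂ)) :
    Continuous (lastFreqFactor s N f) := by
  have := continuous_mI (s := s) hN
  unfold lastFreqFactor
  fun_prop

lemma exists_norm_lastFreqFactor_le {s N : ℝ} (hs : s ≤ 0) (hN : 0 < N) (f : 𝓢(ℝ, ℂ)) :
    ∃ C, ∀ ξ, ‖lastFreqFactor s N f ξ‖ ≤ C := by
  obtain ⟨C, -, hC⟩ := (schwartzFTs f).decay 1 0
  refine ⟨C, fun ξ => ?_⟩
  refine le_trans ?_ (hC (-ξ))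
  rw [norm_iteratedFDeriv_zero, pow_one, lastFreqFactor, norm_mul, Complex.norm_real, norm_mul]
  gcongr
  refine mul_le_of_le_one_left (norm_nonneg _) ?_
  rw [norm_pow, Real.norm_of_nonneg (mI_nonneg hN _)]
  exact pow_le_one₀ (mI_nonneg hN _) (mI_le_one hs hN _)

lemma integrable_lastFreqFactor_mul {s N : ℝ} (hs : s ≤ 0) (hN : 0 < N) (f g : 𝓢(ℝ, ℂ)) :
    Integrable fun ξ => lastFreqFactor s N f ξ * g ξ := by
  obtain ⟨C, hC⟩ := exists_norm_lastFreqFactor_le hs hN f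
  exact g.integrable.bdd_mul (continuous_lastFreqFactor hN f).aestronglyMeasurable
    (Filter.Eventually.of_forall hC)

/-- The form `Lam` with an additive symbol, expressed through the Fourier transform of a power. -/
lemma Lam_sum_eq_integral {s N : ℝ} (hs : s ≤ 0) (hN : 0 < N) (f : 𝓢(ℝ, ℂ)) (n : ℕ) :
    Lam (n + 2) (fun ξ => ((∑ j, mI s N (ξ j) ^ 2 * ξ j : ℝ) : ℂ)) f =
      (n + 2) * (2 * Real.pi) ^ n *
        ∫ ξ, lastFreqFactor s N f ξ * schwartzFTs (schwartzPow f n) ξ := by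
  obtain ⟨C, hC⟩ := exists_norm_lastFreqFactor_le hs hN f
  have hcont := continuous_lastFreqFactor (s := s) hN f
  have hlast : ∀ v : Fin (n + 1) → ℝ,
      ((mI s N (-∑ i, v i) ^ 2 * (-∑ i, v i) : ℝ) : ℂ) *
        ∏ j, schwartzFTs f (padZero (n + 1 + 1) v j) =
      lastFreqFactor s N f (∑ i, v i) * ∏ i, schwartzFTs f (v i) := by
    intro v
    rw [Fin.prod_univ_castSucc]
    simp only [padZero_castSucc, padZero_last, lastFreqFactor]
    ring
  have hint : Integrable fun v : Fin (n + 1) → ℝ =>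
      lastFreqFactor s N f (∑ i, v i) * ∏ i, schwartzFTs f (v i) :=
    (Integrable.fintype_prod fun _ => (schwartzFTs f).integrable).bdd_mul
      (Continuous.aestronglyMeasurable (by fun_prop)) (Filter.Eventually.of_forall fun v => hC _)
  have hsym := integral_sum_mul_prod_padZero (n := n + 1)
    (g := fun ξ => ((mI s N ξ ^ 2 * ξ : ℝ) : ℂ)) (W := schwartzFTs f) (by simpa only [hlast])
  have hconv := integral_comp_sum_mul_prod (F := schwartzFTs f)
    (G := fun n ξ => (2 * Real.pi) ^ n * schwartzFTs (schwartzPow f n) ξ)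
    (schwartzFTs f).integrable (fun n => (schwartzFTs (schwartzPow f n)).integrable.const_mul _)
    (by simp [schwartzPow]) (fun n ξ => by
      simp_rw [mul_left_comm _ ((2 * Real.pi : ℂ) ^ n)]
      rw [integral_const_mul, ← schwartzFTs_pairing_mul, schwartzPow]
      ring) n hcont hC
  simp only [hlast, hconv] at hsym
  rw [Lam, FTs_eq_schwartzFTs]
  push_cast at hsym ⊢
  refine hsym.trans ?_
  simp_rw [mul_left_comm _ ((2 * Real.pi : ℂ) ^ n)]
  rw [integral_const_mul]
  ring

/-- A real-valued Schwartz function regarded as a complex-valued one. -/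
def complexify : 𝓢(ℝ, ℝ) →L[ℝ] 𝓢(ℝ, ℂ) := SchwartzMap.postcompCLM Complex.ofRealCLM

lemma complexify_apply (f : 𝓢(ℝ, ℝ)) (x : ℝ) : complexify f x = (f x : ℂ) := rfl

lemma conj_complexify (f : 𝓢(ℝ, ℝ)) (x : ℝ) :
    (starRingEnd ℂ) (complexify f x) = complexify f x := Complex.conj_ofReal _

lemma conj_schwartzPow_complexify (f : 𝓢(ℝ, ℝ)) (n : ℕ) (x : ℝ) :
    (starRingEnd ℂ) (schwartzPow (complexify f) n x) = schwartzPow (complexify f) n x := by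
  rw [schwartzPow_apply, map_pow, conj_complexify]

lemma derivCLM_complexify (f : 𝓢(ℝ, ℝ)) :
    SchwartzMap.derivCLM ℝ ℂ (complexify f) = complexify (SchwartzMap.derivCLM ℝ ℝ f) := by
  ext x
  rw [SchwartzMap.derivCLM_apply, complexify_apply, SchwartzMap.derivCLM_apply]
  exact (f.hasDerivAt x).ofReal_comp.deriv

/-- The Fourier side of the quartic KdV equation. -/
lemma schwartzFTs_complexify_of_quartic_kdv {u du : 𝓢(ℝ, ℝ)}
    (h : ∀ x, du x + iteratedDeriv 3 u x = deriv (fun y => u y ^ 4) x) (ξ : ℝ) :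
    schwartzFTs (complexify du) ξ = Complex.I * ξ ^ 3 * schwartzFTs (complexify u) ξ +
      Complex.I * ξ * schwartzFTs (schwartzPow (complexify u) 3) ξ := by
  let D := SchwartzMap.derivCLM ℝ ℂ
  have hdu : complexify du = D (schwartzPow (complexify u) 3) - D (D (D (complexify u))) := by
    ext x
    have h3 : D (D (D (complexify u))) x = ((iteratedDeriv 3 u x : ℝ) : ℂ) := by
      simp only [D, derivCLM_complexify, complexify_apply, SchwartzMap.derivCLM_apply,
        iteratedDeriv_succ, iteratedDeriv_zero]
      rfl
    have h4 : D (schwartzPow (complexify u) 3) x = ((deriv (fun y => u y ^ 4) x : ℝ) : ℂ) := by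
      have hd : HasDerivAt (fun y => u y ^ 4) (deriv (fun y => u y ^ 4) x) x :=
        ((u.hasDerivAt x).differentiableAt.pow 4).hasDerivAt
      rw [SchwartzMap.derivCLM_apply, ← hd.ofReal_comp.deriv]
      congr 1
      ext y
      simp [schwartzPow_apply, complexify_apply]
    rw [sub_apply, h3, h4, complexify_apply, ← Complex.ofReal_sub, ← h x,
      add_sub_cancel_right]
  rw [hdu, map_sub, sub_apply, schwartzFTs_deriv, schwartzFTs_deriv,
    schwartzFTs_deriv, schwartzFTs_deriv]
  linear_combination (-Complex.I * ξ ^ 3 * schwartzFTs (complexify u) ξ) * Complex.I_sq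

/-- The measure `m² dξ`. -/
def mIMeasure (s N : ℝ) : Measure ℝ :=
  volume.withDensity fun ξ => (Real.toNNReal (mI s N ξ ^ 2) : ENNReal)

lemma integral_mIMeasure {s N : ℝ} (hN : 0 < N) (F : ℝ → ℝ) :
    ∫ ξ, F ξ ∂mIMeasure s N = ∫ ξ, mI s N ξ ^ 2 * F ξ := by
  have hm : Measurable fun ξ => Real.toNNReal (mI s N ξ ^ 2) :=
    ((continuous_mI hN).pow 2).measurable.real_toNNReal
  rw [mIMeasure, integral_withDensity_eq_integral_smul hm]
  simp [NNReal.smul_def, sq_nonneg]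

lemma mIMeasure_le_volume {s N : ℝ} (hs : s ≤ 0) (hN : 0 < N) : mIMeasure s N ≤ volume := by
  conv_rhs => rw [← withDensity_one (μ := (volume : Measure ℝ))]
  refine withDensity_mono (Filter.Eventually.of_forall fun ξ => ?_)
  simpa [abs_of_nonneg (mI_nonneg hN ξ)] using mI_le_one hs hN ξ

lemma hasTemperateGrowth_mIMeasure {s N : ℝ} (hs : s ≤ 0) (hN : 0 < N) :
    (mIMeasure s N).HasTemperateGrowth := by
  obtain ⟨n, hn⟩ := (inferInstance : (volume : Measure ℝ).HasTemperateGrowth).exists_integrable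
  exact ⟨n, hn.mono_measure (mIMeasure_le_volume hs hN)⟩

/-- The rate of change of the modified energy at a fixed time. -/
lemma two_mul_integral_inner_schwartzFTs {s N : ℝ} (hs : s ≤ 0) (hN : 0 < N) {u du : 𝓢(ℝ, ℝ)}
    (h : ∀ x, du x + iteratedDeriv 3 u x = deriv (fun y => u y ^ 4) x) :
    ((2 * ∫ ξ, inner ℝ (schwartzFTs (complexify u) ξ) (schwartzFTs (complexify du) ξ)
        ∂mIMeasure s N : ℝ) : ℂ) =
      -(2 * Complex.I / 5) * ((((2 * Real.pi) ^ 3)⁻¹ : ℝ) : ℂ) *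
        Lam 5 (fun ξ => ((∑ j, mI s N (ξ j) ^ 2 * ξ j : ℝ) : ℂ)) (fun x => (u x : ℂ)) := by
  set f := complexify u with hf
  set P := schwartzFTs (schwartzPow f 3) with hP
  set J := ∫ ξ, lastFreqFactor s N f ξ * P ξ with hJ
  have hWneg : ∀ ξ, schwartzFTs f (-ξ) = (starRingEnd ℂ) (schwartzFTs f ξ) :=
    schwartzFTs_neg_of_real f (conj_complexify u)
  have hPneg : ∀ ξ, P (-ξ) = (starRingEnd ℂ) (P ξ) :=
    schwartzFTs_neg_of_real _ (conj_schwartzPow_complexify u 3)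
  have hLam : Lam 5 (fun ξ => ((∑ j, mI s N (ξ j) ^ 2 * ξ j : ℝ) : ℂ)) (fun x => (u x : ℂ)) =
      5 * (2 * Real.pi) ^ 3 * J := by
    refine (Lam_sum_eq_integral hs hN f 3).trans ?_
    norm_num [hJ, hP]
  have hJconj : (starRingEnd ℂ) J = -J := by
    rw [hJ, ← integral_conj, ← integral_neg, ← integral_neg_eq_self]
    congr 1 with ξ
    simp only [lastFreqFactor, map_mul, Complex.conj_ofReal, neg_neg, mI_neg, hPneg, hWneg,
      Complex.conj_conj]
    push_cast
    ring
  have hinner : ∫ ξ, inner ℝ (schwartzFTs f ξ) (schwartzFTs (complexify du) ξ) ∂mIMeasure s N =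
      (-Complex.I * J).re := by
    rw [integral_mIMeasure hN, hJ, ← integral_const_mul]
    refine Eq.trans ?_ (integral_re ((integrable_lastFreqFactor_mul hs hN f P).const_mul _))
    congr 1 with ξ
    rw [schwartzFTs_complexify_of_quartic_kdv h, ← hf, ← hP, Complex.inner, lastFreqFactor,
      hWneg, mI_neg, RCLike.re_eq_complex_re]
    simp [pow_succ]
    ring
  have hreal : (((-Complex.I * J).re : ℝ) : ℂ) = -Complex.I * J :=
    Complex.conj_eq_iff_re.1 (by simp [hJconj])
  have hπ : (Real.pi : ℂ) ≠ 0 := by exact_mod_cast Real.pi_ne_zero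
  rw [hinner, Complex.ofReal_mul, hreal, hLam]
  push_cast
  field_simp

lemma hasDerivAt_clm_comp_schwartz {E : Type*} [NormedAddCommGroup E] [NormedSpace ℝ E]
    (A : 𝓢(ℝ, ℝ) →L[ℝ] E) {u : ℝ → 𝓢(ℝ, ℝ)} {u' : 𝓢(ℝ, ℝ)} {t : ℝ}
    (h : Filter.Tendsto (fun h : ℝ => h⁻¹ • (u (t + h) - u t)) (nhdsWithin 0 {0}ᶜ) (nhds u')) :
    HasDerivAt (fun t => A (u t)) (A u') t := by
  rw [hasDerivAt_iff_tendsto_slope_zero]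
  simpa [Function.comp_def] using (A.continuous.tendsto u').comp h

lemma inner_toLp_two {μ : Measure ℝ} [μ.HasTemperateGrowth] (f g : 𝓢(ℝ, ℂ)) :
    inner ℝ (f.toLp 2 μ) (g.toLp 2 μ) = ∫ ξ, inner ℝ (f ξ) (g ξ) ∂μ := by
  rw [L2.inner_def]
  refine integral_congr_ae ?_
  filter_upwards [f.coeFn_toLp 2 μ, g.coeFn_toLp 2 μ] with ξ hf hg
  rw [hf, hg]

theorem quartic_kdv_E1_increment
    (s : ℝ) (hs : s < 0) (N : ℝ) (hN : 1 ≤ N)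
    -- u is a C¹ curve of real-valued Schwartz functions, with derivative du
    (u du : ℝ → SchwartzMap ℝ ℝ)
    (huderiv : ∀ t : ℝ, Filter.Tendsto (fun h : ℝ => h⁻¹ • (u (t + h) - u t))
      (nhdsWithin 0 {0}ᶜ) (nhds (du t)))
    (hducont : Continuous du)
    -- u solves ∂_t u + ∂_x³ u = ∂_x (u⁴)
    (hPDE : ∀ t x : ℝ, du t x + iteratedDeriv 3 (⇑(u t)) x
      = deriv (fun y => (u t) y ^ 4) x)
    (t : ℝ) :
    ((E1 s N u t : ℝ) : ℂ) - ((E1 s N u 0 : ℝ) : ℂ)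
      = -(2 * Complex.I / 5) * ((((2 * Real.pi) ^ 3)⁻¹ : ℝ) : ℂ) *
          ∫ σ in (0:ℝ)..t,
            Lam 5 (fun ξ => ((∑ j, mI s N (ξ j) ^ 2 * ξ j : ℝ) : ℂ))
              (fun x => ((u σ) x : ℂ)) := by
  have hN0 : 0 < N := zero_lt_one.trans_le hN
  have := hasTemperateGrowth_mIMeasure hs.le hN0
  let A : 𝓢(ℝ, ℝ) →L[ℝ] Lp ℂ 2 (mIMeasure s N) :=
    (SchwartzMap.toLpCLM ℝ ℂ 2 (mIMeasure s N)).comp (schwartzFTs.comp complexify)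
  have hinner : ∀ f g : 𝓢(ℝ, ℝ), inner ℝ (A f) (A g) =
      ∫ ξ, inner ℝ (schwartzFTs (complexify f) ξ) (schwartzFTs (complexify g) ξ)
        ∂mIMeasure s N := fun f g => inner_toLp_two _ _
  have hE1 : E1 s N u = fun t => ‖A (u t)‖ ^ 2 := by
    ext t
    rw [← real_inner_self_eq_norm_sq, hinner, integral_mIMeasure hN0]
    simp_rw [real_inner_self_eq_norm_sq, ← FTs_eq_schwartzFTs]
    rfl
  have hderiv : ∀ t, HasDerivAt (fun t => A (u t)) (A (du t)) t :=
    fun t => hasDerivAt_clm_comp_schwartz A (huderiv t)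
  have hcont : Continuous fun t => A (u t) :=
    continuous_iff_continuousAt.2 fun t => (hderiv t).continuousAt
  have hcont' : Continuous fun t => 2 * inner ℝ (A (u t)) (A (du t)) :=
    continuous_const.mul (hcont.inner (A.continuous.comp hducont))
  have hftc := intervalIntegral.integral_eq_sub_of_hasDerivAt
    (fun τ _ => (hderiv τ).norm_sq) (hcont'.intervalIntegrable 0 t)
  rw [hE1, ← Complex.ofReal_sub, ← intervalIntegral.integral_const_mul]
  refine (congrArg Complex.ofReal hftc.symm).trans ?_
  rw [← intervalIntegral.integral_ofReal]
  refine intervalIntegral.integral_congr fun σ _ => ?_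
  simp only [hinner]
  exact two_mul_integral_inner_schwartzFTs hs.le hN0 (hPDE σ)

end
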